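/- (J-IRL regret gap upper bound) There is a universal constant C such that in any finite Markov Game with deviation classes Φ, if the game is u-recoverable with respect to the expert σ_E, the expert satisfies β-coverage, the reward function class F is complete, and the learner σ satisfies the moment-matching guarantee sup_{f∈F} (E_{π_{σ_E}}[(1/H) Σ_{h=1}^H f(s_h, a_h)] − E_{π_σ}[(1/H) Σ_{h=1}^H f(s_h, a_h)]) ≤ ε, then the regret gap satisfies R_Φ(σ) − R_Φ(σ_E) ≤ C·(1/β)·ε·u·H. -/

import Mathlib

open scoped Classical

noncomputable section

namespace MAIL

/-- A finite Markov Game: horizon `H`, transition kernel `T`, per-agent rewards `r`,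
and initial state distribution `ρ₀`.  The agents are indexed by `Fin m`, the state
space is `S`, and agent `i` has action space `A i`; a joint action is an element of
`∀ i, A i`. -/
structure MG (m : ℕ) (S : Type) (A : Fin m → Type) where
  H : ℕ
  T : S → (∀ i, A i) → S → ℝ
  r : Fin m → S → (∀ i, A i) → ℝ
  ρ₀ : S → ℝ

variable {m : ℕ} {S : Type} {A : Fin m → Type} [Fintype S] [∀ i, Fintype (A i)]

/-- The Markov game data is valid: `ρ₀` and each `T s a` are probability
distributions, and all rewards take values in `[-1, 1]`. -/
def IsMG (G : MG m S A) : Prop :=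
  (∀ s, 0 ≤ G.ρ₀ s) ∧ (∑ s, G.ρ₀ s) = 1 ∧
  (∀ s a, (∀ s', 0 ≤ G.T s a s') ∧ (∑ s', G.T s a s') = 1) ∧
  (∀ i s a, |G.r i s a| ≤ 1)

/-- A (mediator or joint) policy is a stochastic map from states to joint actions.
When all agents obediently follow the mediator policy `σ`, the induced joint policy
`π_σ` is `σ` itself. -/
def IsPolicy (π : S → (∀ i, A i) → ℝ) : Prop :=
  ∀ s, (∀ a, 0 ≤ π s a) ∧ (∑ a, π s a) = 1

/-- Distribution over states at (0-indexed) step `h` under joint policy `π`. -/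
def stateDist (G : MG m S A) (π : S → (∀ i, A i) → ℝ) : ℕ → S → ℝ
  | 0 => G.ρ₀
  | h + 1 => fun s' => ∑ s, ∑ a, stateDist G π h s * π s a * G.T s a s'

/-- Expected cumulative reward over horizon `G.H` of joint policy `π` when every
agent's reward function is `f`, i.e. `J(π, f)`. -/
def Jf (G : MG m S A) (π : S → (∀ i, A i) → ℝ) (f : S → (∀ i, A i) → ℝ) : ℝ :=
  ∑ h ∈ Finset.range G.H, ∑ s, ∑ a, stateDist G π h s * π s a * f s a

/-- Value `J_i(π)` of joint policy `π` for agent `i` under the true rewards. -/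
def J (G : MG m S A) (i : Fin m) (π : S → (∀ i, A i) → ℝ) : ℝ :=
  Jf G π (G.r i)

/-- Occupancy measure `ρ^π(s, a) = (1/H) ∑_h Pr_π(s_h = s, a_h = a)`. -/
def occ (G : MG m S A) (π : S → (∀ i, A i) → ℝ) (s : S) (a : ∀ i, A i) : ℝ :=
  (∑ h ∈ Finset.range G.H, stateDist G π h s * π s a) / G.H

/-- Average state visitation distribution `d^π(s) = ∑_a ρ^π(s, a)`. -/
def dAvg (G : MG m S A) (π : S → (∀ i, A i) → ℝ) (s : S) : ℝ :=
  ∑ a, occ G π s a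

/-- The joint policy `π_{σ, φ_i}` obtained from mediator policy `σ` when agent `i`
deviates via `φ : S → A i → A i` (playing `φ s a` when recommended `a` at state `s`)
while all other agents follow their recommendations. -/
def dev (σ : S → (∀ i, A i) → ℝ) (i : Fin m) (φ : S → A i → A i) :
    S → (∀ i, A i) → ℝ :=
  fun s b => ∑ a : ∀ j, A j, if Function.update a i (φ s (a i)) = b then σ s a else 0

/-- Regret `R_Φ(σ, f)` of mediator policy `σ` w.r.t. deviation classes `Φ`, when
`f` is used as every agent's reward function. -/
def regretF (G : MG m S A) (σ : S → (∀ i, A i) → ℝ)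
    (Φ : ∀ i : Fin m, Set (S → A i → A i)) (f : S → (∀ i, A i) → ℝ) : ℝ :=
  ⨆ i : Fin m, ⨆ φ : Φ i, (Jf G (dev σ i φ.1) f - Jf G σ f)

/-- Regret `R_Φ(σ)` of mediator policy `σ` under the true rewards. -/
def regret (G : MG m S A) (σ : S → (∀ i, A i) → ℝ)
    (Φ : ∀ i : Fin m, Set (S → A i → A i)) : ℝ :=
  ⨆ i : Fin m, ⨆ φ : Φ i, (J G i (dev σ i φ.1) - J G i σ)

/-- Value-to-go `V` of joint policy `π` with `k` steps remaining (so the value from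
step `h` in the paper corresponds to `k = H - h` remaining steps), with every
agent's reward given by `f`. -/
def Vgo (G : MG m S A) (f : S → (∀ i, A i) → ℝ) (π : S → (∀ i, A i) → ℝ) :
    ℕ → S → ℝ
  | 0 => fun _ => 0
  | k + 1 => fun s => ∑ a, π s a * (f s a + ∑ s', G.T s a s' * Vgo G f π k s')

/-- Q-value of joint policy `π` with `k` steps remaining. -/
def Qgo (G : MG m S A) (f : S → (∀ i, A i) → ℝ) (π : S → (∀ i, A i) → ℝ)
    (k : ℕ) (s : S) (a : ∀ i, A i) : ℝ :=
  match k with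
  | 0 => 0
  | k + 1 => f s a + ∑ s', G.T s a s' * Vgo G f π k s'

/-- Advantage `A = Q - V` of joint policy `π` with `k` steps remaining. -/
def Adv (G : MG m S A) (f : S → (∀ i, A i) → ℝ) (π : S → (∀ i, A i) → ℝ)
    (k : ℕ) (s : S) (a : ∀ i, A i) : ℝ :=
  Qgo G f π k s a - Vgo G f π k s

/-- `u`-recoverability: the advantage of any expert-plus-single-deviation joint
policy `π_{σ_E, φ_i}` is bounded by `u` at every state, joint action, and step. -/
def Recoverable (G : MG m S A) (Φ : ∀ i : Fin m, Set (S → A i → A i))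
    (σE : S → (∀ i, A i) → ℝ) (u : ℝ) : Prop :=
  ∀ i : Fin m, ∀ φ ∈ Φ i, ∀ k ≤ G.H, ∀ s a, |Adv G (G.r i) (dev σE i φ) k s a| ≤ u

/-- `β`-coverage: the expert's average state distribution puts mass at least `β`
on every state. -/
def Coverage (G : MG m S A) (σE : S → (∀ i, A i) → ℝ) (β : ℝ) : Prop :=
  ∀ s, β ≤ dAvg G σE s

/-- Total variation distance between two finitely supported distributions. -/
def tv {α : Type} [Fintype α] (p q : α → ℝ) : ℝ :=
  (∑ a, |p a - q a|) / 2

theorem stateDist_nonneg {G : MG m S A} (hG : IsMG G) {π : S → (∀ i, A i) → ℝ}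
    (hπ : IsPolicy π) (h : ℕ) (s : S) : 0 ≤ stateDist G π h s := by
  induction h generalizing s with
  | zero => exact hG.1 s
  | succ h ih =>
    exact Finset.sum_nonneg fun s' _ => Finset.sum_nonneg fun a _ =>
      mul_nonneg (mul_nonneg (ih s') ((hπ s').1 a)) ((hG.2.2.1 s' a).1 s)

theorem sum_stateDist {G : MG m S A} (hG : IsMG G) {π : S → (∀ i, A i) → ℝ}
    (hπ : IsPolicy π) (h : ℕ) : ∑ s, stateDist G π h s = 1 := by
  induction h with
  | zero => exact hG.2.1
  | succ h ih =>
    calc ∑ s', stateDist G π (h + 1) s'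
        = ∑ s, ∑ a, stateDist G π h s * π s a * ∑ s', G.T s a s' := by
          simp only [stateDist, Finset.mul_sum]
          rw [Finset.sum_comm]
          exact Finset.sum_congr rfl fun s _ => Finset.sum_comm
      _ = 1 := by
          simp only [(hG.2.2.1 _ _).2, mul_one, ← Finset.mul_sum, (hπ _).2, ih]

theorem stateDist_le_one {G : MG m S A} (hG : IsMG G) {π : S → (∀ i, A i) → ℝ}
    (hπ : IsPolicy π) (h : ℕ) (s : S) : stateDist G π h s ≤ 1 := by
  rw [← sum_stateDist hG hπ h]
  exact Finset.single_le_sum (fun s _ => stateDist_nonneg hG hπ h s) (Finset.mem_univ s)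

theorem sum_mul_Qgo_self (G : MG m S A) (f π : S → (∀ i, A i) → ℝ) (k : ℕ) (s : S) :
    ∑ a, π s a * Qgo G f π k s a = Vgo G f π k s := by
  cases k <;> simp [Qgo, Vgo]

theorem sum_mul_Adv (G : MG m S A) (f π : S → (∀ i, A i) → ℝ) {π' : S → (∀ i, A i) → ℝ}
    (hπ' : IsPolicy π') (k : ℕ) (s : S) :
    ∑ a, π' s a * Adv G f π k s a = ∑ a, π' s a * Qgo G f π k s a - Vgo G f π k s := by
  simp only [Adv, mul_sub, Finset.sum_sub_distrib, ← Finset.sum_mul, (hπ' s).2, one_mul]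

theorem sum_mul_Adv_self (G : MG m S A) (f : S → (∀ i, A i) → ℝ) {π : S → (∀ i, A i) → ℝ}
    (hπ : IsPolicy π) (k : ℕ) (s : S) : ∑ a, π s a * Adv G f π k s a = 0 := by
  rw [sum_mul_Adv G f π hπ, sum_mul_Qgo_self, sub_self]

theorem sum_stateDist_mul_Qgo_succ (G : MG m S A) (f π π' : S → (∀ i, A i) → ℝ) (h k : ℕ) :
    ∑ s, stateDist G π' h s * ∑ a, π' s a * Qgo G f π (k + 1) s a
      = ∑ s, ∑ a, stateDist G π' h s * π' s a * f s a
        + ∑ s, stateDist G π' (h + 1) s * Vgo G f π k s := by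
  have key : ∑ s', stateDist G π' (h + 1) s' * Vgo G f π k s'
      = ∑ s, ∑ a, stateDist G π' h s * π' s a * ∑ s', G.T s a s' * Vgo G f π k s' := by
    simp only [stateDist, Finset.mul_sum, Finset.sum_mul]
    rw [Finset.sum_comm]
    refine Finset.sum_congr rfl fun s _ => ?_
    rw [Finset.sum_comm]
    exact Finset.sum_congr rfl fun a _ => Finset.sum_congr rfl fun s' _ => by ring
  rw [key]
  simp only [Qgo, mul_add, Finset.sum_add_distrib, Finset.mul_sum, mul_assoc]

/-- The performance difference identity, relative to the value function of `π` at the start. -/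
theorem Jf_eq_add_sum_Adv (G : MG m S A) (f π : S → (∀ i, A i) → ℝ)
    {π' : S → (∀ i, A i) → ℝ} (hπ' : IsPolicy π') :
    Jf G π' f = ∑ s, G.ρ₀ s * Vgo G f π G.H s
      + ∑ h ∈ Finset.range G.H, ∑ s, stateDist G π' h s *
          ∑ a, π' s a * Adv G f π (G.H - h) s a := by
  set W : ℕ → ℝ := fun h => ∑ s, stateDist G π' h s * Vgo G f π (G.H - h) s with hW
  have step : ∀ h ∈ Finset.range G.H, ∑ s, stateDist G π' h s *
      ∑ a, π' s a * Adv G f π (G.H - h) s a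
      = ∑ s, ∑ a, stateDist G π' h s * π' s a * f s a + (W (h + 1) - W h) := by
    intro h hh
    obtain ⟨k, hk⟩ : ∃ k, G.H - h = k + 1 := ⟨G.H - h - 1, by grind⟩
    have hk' : G.H - (h + 1) = k := by omega
    simp only [hW, sum_mul_Adv G f π hπ', mul_sub, Finset.sum_sub_distrib, hk, hk',
      sum_stateDist_mul_Qgo_succ]
    ring
  have hWH : W G.H = 0 := by simp [hW, Vgo]
  have hW0 : W 0 = ∑ s, G.ρ₀ s * Vgo G f π G.H s := rfl
  rw [Finset.sum_congr rfl step, Finset.sum_add_distrib, Finset.sum_range_sub, hWH, hW0, Jf]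
  ring

/-- The performance difference lemma. -/
theorem Jf_sub_Jf (G : MG m S A) (f : S → (∀ i, A i) → ℝ) {π π' : S → (∀ i, A i) → ℝ}
    (hπ : IsPolicy π) (hπ' : IsPolicy π') :
    Jf G π' f - Jf G π f = ∑ h ∈ Finset.range G.H, ∑ s, stateDist G π' h s *
      ∑ a, π' s a * Adv G f π (G.H - h) s a := by
  rw [Jf_eq_add_sum_Adv G f π hπ', Jf_eq_add_sum_Adv G f π hπ]
  simp only [sum_mul_Adv_self G f hπ, mul_zero, Finset.sum_const_zero]
  ring

theorem abs_sum_mul_Adv_le (G : MG m S A) (f : S → (∀ i, A i) → ℝ)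
    {π π' : S → (∀ i, A i) → ℝ} (hπ : IsPolicy π) {u : ℝ} {k : ℕ} {s : S}
    (hu : ∀ a, |Adv G f π k s a| ≤ u) :
    |∑ a, π' s a * Adv G f π k s a| ≤ u * ∑ a, |π' s a - π s a| := by
  have hsub : ∑ a, π' s a * Adv G f π k s a = ∑ a, (π' s a - π s a) * Adv G f π k s a := by
    simp only [sub_mul, Finset.sum_sub_distrib, sum_mul_Adv_self G f hπ, sub_zero]
  rw [hsub, Finset.mul_sum]
  refine (Finset.abs_sum_le_sum_abs _ _).trans (Finset.sum_le_sum fun a _ => ?_)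
  rw [abs_mul, mul_comm]
  exact mul_le_mul_of_nonneg_right (hu a) (abs_nonneg _)

theorem abs_Jf_sub_Jf_le {G : MG m S A} (hG : IsMG G) (f : S → (∀ i, A i) → ℝ)
    {π π' : S → (∀ i, A i) → ℝ} (hπ : IsPolicy π) (hπ' : IsPolicy π') {u : ℝ}
    (hu : ∀ k ≤ G.H, ∀ s a, |Adv G f π k s a| ≤ u) :
    |Jf G π' f - Jf G π f| ≤ G.H * (u * ∑ s, ∑ a, |π' s a - π s a|) := by
  rw [Jf_sub_Jf G f hπ hπ']
  refine (Finset.abs_sum_le_sum_abs _ _).trans ?_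
  rw [← nsmul_eq_mul]
  refine (Finset.sum_le_card_nsmul _ _ _ fun h _ => ?_).trans_eq
    (congrArg (· • _) (Finset.card_range _))
  rw [Finset.mul_sum]
  refine (Finset.abs_sum_le_sum_abs _ _).trans (Finset.sum_le_sum fun s _ => ?_)
  rw [abs_mul, abs_of_nonneg (stateDist_nonneg hG hπ' h s)]
  exact (mul_le_of_le_one_left (abs_nonneg _) (stateDist_le_one hG hπ' h s)).trans
    (abs_sum_mul_Adv_le G f hπ (hu _ (Nat.sub_le _ _) s))

omit [Fintype S] in
theorem isPolicy_dev {σ : S → (∀ i, A i) → ℝ} (hσ : IsPolicy σ) (i : Fin m)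
    (φ : S → A i → A i) : IsPolicy (dev σ i φ) := by
  refine fun s => ⟨fun b => Finset.sum_nonneg fun a _ => ?_, ?_⟩
  · split_ifs
    exacts [(hσ s).1 a, le_rfl]
  · simp only [dev]
    rw [Finset.sum_comm]
    simpa using (hσ s).2

omit [Fintype S] in
theorem sum_abs_dev_sub_dev_le (σ τ : S → (∀ i, A i) → ℝ) (i : Fin m)
    (φ : S → A i → A i) (s : S) :
    ∑ b, |dev σ i φ s b - dev τ i φ s b| ≤ ∑ a, |σ s a - τ s a| := by
  calc ∑ b, |dev σ i φ s b - dev τ i φ s b|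
      ≤ ∑ b, ∑ a : ∀ j, A j,
          if Function.update a i (φ s (a i)) = b then |σ s a - τ s a| else 0 := by
        refine Finset.sum_le_sum fun b _ => ?_
        simp only [dev, ← Finset.sum_sub_distrib]
        refine (Finset.abs_sum_le_sum_abs _ _).trans_eq (Finset.sum_congr rfl fun a _ => ?_)
        split_ifs <;> simp
    _ = ∑ a, |σ s a - τ s a| := by
        rw [Finset.sum_comm]
        simp

omit [Fintype S] in
theorem dev_id (σ : S → (∀ i, A i) → ℝ) (i : Fin m) : dev σ i (fun _ a => a) = σ := by
  ext s b
  simp [dev]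

theorem occ_eq_dAvg_mul {G : MG m S A} {π : S → (∀ i, A i) → ℝ} (hπ : IsPolicy π) (s : S)
    (a : ∀ i, A i) : occ G π s a = dAvg G π s * π s a := by
  have hocc : ∀ b, occ G π s b = (∑ h ∈ Finset.range G.H, stateDist G π h s) / G.H * π s b := by
    intro b
    rw [occ, ← Finset.sum_mul, div_mul_eq_mul_div]
  simp only [dAvg, hocc, ← Finset.mul_sum, (hπ s).2, mul_one]

theorem Jf_div_H (G : MG m S A) (π f : S → (∀ i, A i) → ℝ) :
    Jf G π f / G.H = ∑ s, ∑ a, occ G π s a * f s a := by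
  simp only [Jf, occ, div_mul_eq_mul_div, Finset.sum_mul, ← Finset.sum_div]
  congr 1
  rw [Finset.sum_comm]
  exact Finset.sum_congr rfl fun s _ => Finset.sum_comm

/-- Moment matching over all `[-1, 1]`-valued functions bounds the `ℓ¹` distance between
occupancy measures. -/
theorem sum_abs_occ_sub_occ_le {G : MG m S A} {σE σ : S → (∀ i, A i) → ℝ} {ε : ℝ}
    (h : ∀ f : S → (∀ i, A i) → ℝ, (∀ s a, |f s a| ≤ 1) →
      Jf G σE f / G.H - Jf G σ f / G.H ≤ ε) :
    ∑ s, ∑ a, |occ G σE s a - occ G σ s a| ≤ ε := by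
  have hf := h (fun s a => if 0 ≤ occ G σE s a - occ G σ s a then 1 else -1)
    (fun s a => by split_ifs <;> simp)
  simp only [Jf_div_H, ← Finset.sum_sub_distrib, ← sub_mul] at hf
  refine le_trans (le_of_eq ?_) hf
  refine Finset.sum_congr rfl fun s _ => Finset.sum_congr rfl fun a _ => ?_
  split_ifs with h0
  · rw [abs_of_nonneg h0, mul_one]
  · rw [abs_of_neg (not_le.mp h0)]
    ring

theorem dAvg_mul_sum_abs_sub_le {G : MG m S A} (hG : IsMG G) {σE σ : S → (∀ i, A i) → ℝ}
    (hE : IsPolicy σE) (hσ : IsPolicy σ) (s : S) :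
    dAvg G σE s * ∑ a, |σ s a - σE s a| ≤ 2 * ∑ a, |occ G σE s a - occ G σ s a| := by
  have hd : |dAvg G σE s - dAvg G σ s| ≤ ∑ a, |occ G σE s a - occ G σ s a| := by
    simp only [dAvg, ← Finset.sum_sub_distrib]
    exact Finset.abs_sum_le_sum_abs _ _
  have hpos : 0 ≤ dAvg G σE s := Finset.sum_nonneg fun a _ => div_nonneg
    (Finset.sum_nonneg fun h _ => mul_nonneg (stateDist_nonneg hG hE h s) ((hE s).1 a))
    (Nat.cast_nonneg _)
  have hterm : ∀ a, dAvg G σE s * |σ s a - σE s a|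
      ≤ |occ G σE s a - occ G σ s a| + |dAvg G σE s - dAvg G σ s| * σ s a := by
    intro a
    have heq : dAvg G σE s * (σ s a - σE s a) =
        -(occ G σE s a - occ G σ s a) + (dAvg G σE s - dAvg G σ s) * σ s a := by
      rw [occ_eq_dAvg_mul hE, occ_eq_dAvg_mul hσ]
      ring
    calc dAvg G σE s * |σ s a - σE s a| = |dAvg G σE s * (σ s a - σE s a)| := by
          rw [abs_mul, abs_of_nonneg hpos]
      _ ≤ |-(occ G σE s a - occ G σ s a)| + |(dAvg G σE s - dAvg G σ s) * σ s a| := by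
          rw [heq]
          exact abs_add_le _ _
      _ = _ := by rw [abs_neg, abs_mul, abs_of_nonneg ((hσ s).1 a)]
  rw [Finset.mul_sum]
  refine (Finset.sum_le_sum fun a _ => hterm a).trans ?_
  rw [Finset.sum_add_distrib, ← Finset.mul_sum, (hσ s).2]
  linarith

theorem mul_sum_abs_sub_le {G : MG m S A} (hG : IsMG G) {σE σ : S → (∀ i, A i) → ℝ}
    (hE : IsPolicy σE) (hσ : IsPolicy σ) {β ε : ℝ} (hcov : Coverage G σE β)
    (h : ∀ f : S → (∀ i, A i) → ℝ, (∀ s a, |f s a| ≤ 1) →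
      Jf G σE f / G.H - Jf G σ f / G.H ≤ ε) :
    β * ∑ s, ∑ a, |σ s a - σE s a| ≤ 2 * ε := by
  calc β * ∑ s, ∑ a, |σ s a - σE s a|
      ≤ ∑ s, dAvg G σE s * ∑ a, |σ s a - σE s a| := by
        rw [Finset.mul_sum]
        exact Finset.sum_le_sum fun s _ => mul_le_mul_of_nonneg_right (hcov s)
          (Finset.sum_nonneg fun a _ => abs_nonneg _)
    _ ≤ ∑ s, 2 * ∑ a, |occ G σE s a - occ G σ s a| :=
        Finset.sum_le_sum fun s _ => dAvg_mul_sum_abs_sub_le hG hE hσ s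
    _ ≤ 2 * ε := by
        rw [← Finset.mul_sum]
        exact mul_le_mul_of_nonneg_left (sum_abs_occ_sub_occ_le h) zero_le_two

theorem regret_le_regret_add (G : MG m S A) (hm : 0 < m) {σ σE : S → (∀ i, A i) → ℝ}
    {Φ : ∀ i : Fin m, Set (S → A i → A i)} (hΦ : ∀ i, (Φ i).Nonempty) {K : ℝ}
    (h : ∀ i, ∀ φ ∈ Φ i, J G i (dev σ i φ) - J G i σ
      ≤ J G i (dev σE i φ) - J G i σE + K) :
    regret G σ Φ ≤ regret G σE Φ + K := by
  have : Nonempty (Fin m) := ⟨⟨0, hm⟩⟩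
  refine ciSup_le fun i => ?_
  have := (hΦ i).to_subtype
  refine ciSup_le fun φ => (h i φ.1 φ.2).trans (add_le_add_left ?_ K)
  refine le_trans ?_ (le_ciSup (Set.finite_range _).bddAbove i)
  exact le_ciSup (f := fun ψ : Φ i => J G i (dev σE i ψ.1) - J G i σE)
    (Set.finite_range _).bddAbove φ

/-- **J-IRL regret gap upper bound.** There is a universal constant
`C` such that in any `u`-recoverable finite Markov Game whose expert satisfies
`β`-coverage, a moment-matching guarantee of `ε` over the complete reward class
(all functions `S × A → [-1,1]`) implies a regret gap of at most
`C·(1/β)·ε·u·H`. -/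
theorem jirl_regret_gap_upper_bound :
    ∃ C : ℝ, 0 < C ∧
      ∀ (m : ℕ) (S : Type) (A : Fin m → Type) [Fintype S] [∀ i, Fintype (A i)]
        (G : MG m S A), IsMG G → 0 < m →
        ∀ (Φ : ∀ i : Fin m, Set (S → A i → A i)),
        (∀ i : Fin m, (fun (_ : S) (a : A i) => a) ∈ Φ i) →
        ∀ (σE σ : S → (∀ i, A i) → ℝ), IsPolicy σE → IsPolicy σ →
        ∀ (u β ε : ℝ), Recoverable G Φ σE u → 0 < β → Coverage G σE β →
        (∀ f : S → (∀ i, A i) → ℝ, (∀ s a, |f s a| ≤ 1) →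
          Jf G σE f / G.H - Jf G σ f / G.H ≤ ε) →
        regret G σ Φ - regret G σE Φ ≤ C * (1 / β) * ε * u * G.H := by
  refine ⟨4, by norm_num, ?_⟩
  intro m S A _ _ G hG hm Φ hΦ σE σ hE hσ u β ε hu hβ hcov hmatch
  have hdist := mul_sum_abs_sub_le hG hE hσ hcov hmatch
  set D := ∑ s, ∑ a, |σ s a - σE s a| with hD
  have hu0 : 0 ≤ u := by
    obtain ⟨s, -, -⟩ := Finset.exists_ne_zero_of_sum_ne_zero
      (hG.2.1.trans_ne one_ne_zero)
    obtain ⟨a, -, -⟩ := Finset.exists_ne_zero_of_sum_ne_zero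
      ((hE s).2.trans_ne one_ne_zero)
    exact (abs_nonneg _).trans (hu ⟨0, hm⟩ _ (hΦ _) 0 (Nat.zero_le _) s a)
  have hDle : D ≤ 2 * ε / β := by rwa [le_div_iff₀' hβ]
  have hbound : ∀ X ≤ D, G.H * (u * X) ≤ G.H * (u * (2 * ε / β)) := fun X hX =>
    mul_le_mul_of_nonneg_left (mul_le_mul_of_nonneg_left (hX.trans hDle) hu0)
      (Nat.cast_nonneg _)
  rw [sub_le_iff_le_add']
  refine regret_le_regret_add G hm (fun i => ⟨_, hΦ i⟩) fun i φ hφ => ?_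
  have hdev := (abs_Jf_sub_Jf_le hG (G.r i) (isPolicy_dev hE i φ) (isPolicy_dev hσ i φ)
    (hu i φ hφ)).trans (hbound _ (Finset.sum_le_sum fun s _ =>
      sum_abs_dev_sub_dev_le σ σE i φ s))
  have hid := hu i _ (hΦ i)
  rw [dev_id] at hid
  have hself := (abs_Jf_sub_Jf_le hG (G.r i) hE hσ hid).trans (hbound _ le_rfl)
  have hC : 4 * (1 / β) * ε * u * G.H = 2 * (G.H * (u * (2 * ε / β))) := by ring
  have hdev_le := (abs_le.mp hdev).2
  have hself_le := (abs_le.mp hself).1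
  simp only [J]
  linarith

end MAIL
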